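/- Fix k ≥ 3. For r ≥ 0 let N_r(x) = Σ_{n≥0} a_n x^n where a_n is the number of Motzkin permutations of length n with exactly r occurrences of the generalized pattern 21-3-…-k. Then N_0(x)·(q_{k−2}(x) − x²·q_{k−3}(x)) = q_{k−3}(x) − x²·q_{k−4}(x), and for every 1 ≤ r ≤ k−1, N_r(x)·(q_{k−2}(x) − x²·q_{k−3}(x))^{r+1} = x^{2k+r−4}·(1+x)^r·q_{k−2}(x)^{r−1}. Equivalently, N_0(x) = (U_{k−3}(s) − x U_{k−4}(s)) / (x(U_{k−2}(s) − x U_{k−3}(s))) and N_r(x) = x^r(1+x)^r U_{k−2}(s)^{r−1} / (U_{k−2}(s) − x U_{k−3}(s))^{r+1} with s = (1−x)/(2x). -/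

import Mathlib

/-- `π` avoids the classical pattern 132. -/
def Avoids132 {n : ℕ} (π : Equiv.Perm (Fin n)) : Prop :=
  ¬ ∃ i j k : Fin n, i < j ∧ j < k ∧ π i < π k ∧ π k < π j

/-- `π` avoids the generalized pattern 1-23. -/
def Avoids1_23 {n : ℕ} (π : Equiv.Perm (Fin n)) : Prop :=
  ¬ ∃ (a b : Fin n) (h : (b : ℕ) + 1 < n), a < b ∧ π a < π b ∧ π b < π ⟨(b : ℕ) + 1, h⟩

/-- A Motzkin permutation avoids both 132 and 1-23. -/
def IsMotzkinPerm {n : ℕ} (π : Equiv.Perm (Fin n)) : Prop :=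
  Avoids132 π ∧ Avoids1_23 π

/-- The number of occurrences of the generalized pattern `21-3-…-k` in `π`: sequences of
indices `i₁ < i₂ < … < i_k` with `i₂ = i₁ + 1` and `π i₂ < π i₁ < π i₃ < π i₄ < … < π i_k`.
An occurrence is encoded as the pair of `i₁` and the strictly increasing map picking
`i₃ < … < i_k`. -/
noncomputable def occ21_3k (k : ℕ) {n : ℕ} (π : Equiv.Perm (Fin n)) : ℕ :=
  Nat.card {p : Fin n × (Fin (k - 2) → Fin n) //
    ∃ h : (p.1 : ℕ) + 1 < n,
      StrictMono p.2 ∧ (∀ i, (⟨(p.1 : ℕ) + 1, h⟩ : Fin n) < p.2 i) ∧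
      π ⟨(p.1 : ℕ) + 1, h⟩ < π p.1 ∧ (∀ i, π p.1 < π (p.2 i)) ∧
      StrictMono fun i => π (p.2 i)}

/-- `qcheb r` is the polynomial `q_{r-1}`, where `q_{-1} = 0`, `q_0 = 1` and
`q_{r+1} = (1-x) q_r - x² q_{r-1}`; equivalently `q_r(x) = x^r U_r((1-x)/(2x))`. -/
noncomputable def qcheb : ℕ → PowerSeries ℚ
  | 0 => 0
  | 1 => 1
  | (r + 2) => (1 - PowerSeries.X) * qcheb (r + 1) - PowerSeries.X ^ 2 * qcheb r

inductive MT : Type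
  | nil : MT
  | one : MT → MT
  | two : MT → MT → MT

namespace MT

open Classical in
noncomputable instance : DecidableEq MT := Classical.decEq _

def size : MT → ℕ
  | nil => 0
  | one R => size R + 1
  | two L R => size L + size R + 2

def o : ℕ → MT → ℕ
  | _, nil => 0
  | 0, one R => 1 + o 0 R
  | 0, two L R => 1 + o 0 L + o 0 R
  | j+1, one R => o (j+1) R
  | j+1, two L R => o (j+1) L + o j L + o (j+1) R

theorem o_bound (t : MT) : ∀ j, 1 ≤ o (j+1) t → j + 2 ≤ o j t := by
  induction t with
  | nil => intro j h; simp [o] at h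
  | one R ih =>
    intro j h
    have := ih j (by simpa [o] using h)
    cases j <;> simp [o] <;> omega
  | two L R ihL ihR =>
    intro j h
    simp only [o] at h
    have h1 := ihL j
    have h2 := ihR j
    cases j with
    | zero => simp only [o]; omega
    | succ i =>
      have h3 := ihL i
      simp only [o]; omega

noncomputable def upTo : ℕ → Finset MT
  | 0 => ∅
  | n+1 => {nil} ∪ (upTo n).image one ∪ Finset.image₂ two (upTo n) (upTo n)

theorem mem_upTo (t : MT) : ∀ n, size t < n → t ∈ upTo n := by
  induction t with
  | nil => intro n h; cases n <;> simp [upTo] at h ⊢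
  | one R ih =>
    intro n h
    cases n with
    | zero => simp at h
    | succ n =>
      have := ih n (by simp [size] at h; omega)
      simp [upTo, this]
  | two L R ihL ihR =>
    intro n h
    cases n with
    | zero => simp at h
    | succ n =>
      have := ihL n (by simp [size] at h; omega)
      have := ihR n (by simp [size] at h; omega)
      simp [upTo, Finset.mem_image₂, *]

noncomputable def T (n : ℕ) : Finset MT := (upTo (n+1)).filter (fun t => size t = n)

theorem mem_T (n : ℕ) (t : MT) : t ∈ T n ↔ size t = n := by
  simp only [T, Finset.mem_filter, and_iff_right_iff_imp]
  intro h
  exact mem_upTo t _ (by omega)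

theorem T_zero : T 0 = {nil} := by
  ext t; cases t <;> simp [mem_T, size]

theorem sum_T_one (w : MT → ℚ) : ∑ t ∈ T 1, w t = ∑ t ∈ T 0, w (one t) := by
  have : T 1 = {one nil} := by
    ext t
    cases t with
    | nil => simp [mem_T, size]
    | one R => cases R <;> simp [mem_T, size]
    | two L R => simp [mem_T, size]
  simp [this, T_zero]

theorem sum_T_add_two (w : MT → ℚ) (n : ℕ) : ∑ t ∈ T (n+2), w t =
    ∑ t ∈ T (n+1), w (one t) +
      ∑ p ∈ Finset.HasAntidiagonal.antidiagonal n, ∑ L ∈ T p.1, ∑ R ∈ T p.2, w (two L R) := by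
  have h : T (n+2) = (T (n+1)).image one ∪ (Finset.HasAntidiagonal.antidiagonal n).biUnion
      (fun p => Finset.image₂ two (T p.1) (T p.2)) := by
    ext t
    cases t with
    | nil => simp [mem_T, size, Finset.mem_image₂]
    | one R => simp [mem_T, size, Finset.mem_image₂]
    | two L R => simp [mem_T, size, Finset.mem_image₂]
  rw [h, Finset.sum_union, Finset.sum_image, Finset.sum_biUnion]
  · congr 1
    refine Finset.sum_congr rfl fun p _ => ?_
    rw [← Finset.sum_product', Finset.image₂, Finset.sum_image]
    · rfl
    · rintro ⟨a, b⟩ _ ⟨c, d⟩ _ h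
      simpa using h
  · rintro ⟨a, b⟩ h1 ⟨c, d⟩ h2 hne
    rw [Function.onFun, Finset.disjoint_left]
    intro t h3 h4
    simp only [Finset.mem_image₂, mem_T] at h3 h4
    obtain ⟨L, hL, R, hR, rfl⟩ := h3
    obtain ⟨L', hL', R', hR', h⟩ := h4
    simp only [two.injEq] at h
    obtain ⟨rfl, rfl⟩ := h
    apply hne; simp; omega
  · intro a _ b _ h; simpa using h
  · rw [Finset.disjoint_left]
    intro t h3 h4
    simp only [Finset.mem_image, Finset.mem_biUnion, Finset.mem_image₂] at h3 h4
    obtain ⟨_, _, rfl⟩ := h3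
    obtain ⟨_, _, _, _, _, _, h⟩ := h4
    cases h

open PowerSeries

noncomputable def gf (w : MT → ℚ) : PowerSeries ℚ := PowerSeries.mk fun n => ∑ t ∈ T n, w t

theorem gf_rec {ι : Type*} (s : Finset ι) (w v : MT → ℚ) (f g : ι → MT → ℚ)
    (h1 : ∀ t, w (one t) = v t)
    (h2 : ∀ L R, w (two L R) = ∑ i ∈ s, f i L * g i R) :
    gf w = C (w nil) + X * gf v + X^2 * ∑ i ∈ s, gf (f i) * gf (g i) := by
  ext n
  match n with
  | 0 => simp [gf, T_zero, pow_two, mul_assoc]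
  | 1 =>
    simp only [gf, map_add, coeff_mk, sum_T_one, h1, pow_two, mul_assoc]
    rw [show (1:ℕ) = 0 + 1 from rfl, coeff_succ_X_mul, coeff_succ_X_mul]
    simp [coeff_C]
  | n+2 =>
    simp only [gf, map_add, coeff_mk, sum_T_add_two, h1, h2, pow_two, mul_assoc]
    rw [show n+2 = (n + 1) + 1 from rfl, coeff_succ_X_mul, coeff_succ_X_mul, coeff_succ_X_mul]
    simp only [coeff_C, coeff_mk, map_sum, coeff_mul]
    simp only [Nat.add_eq_zero_iff, one_ne_zero, and_false, if_false, zero_add]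
    congr 1
    rw [Finset.sum_comm (s := s)]
    refine Finset.sum_congr rfl fun p _ => ?_
    simp only [Finset.sum_mul_sum]
    simp only [Finset.sum_comm (s := s)]

def w (j r : ℕ) (t : MT) : ℚ := if o j t = r ∧ o (j+1) t = 0 then 1 else 0

noncomputable def A (j r : ℕ) : PowerSeries ℚ := gf (w j r)

theorem o_zero_eq_zero (t : MT) : o 0 t = 0 ↔ t = nil := by
  cases t <;> simp [o]

theorem A_succ (j r : ℕ) : A (j+1) r = (if r = 0 then 1 else 0) + X * A (j+1) r +
    X^2 * ∑ p ∈ Finset.HasAntidiagonal.antidiagonal r, A j p.1 * A (j+1) p.2 := by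
  conv_lhs => unfold A
  rw [gf_rec (Finset.HasAntidiagonal.antidiagonal r) (w (j+1) r) (w (j+1) r)
    (fun p => w j p.1) (fun p => w (j+1) p.2)]
  · simp only [A]
    congr 2
    by_cases h : r = 0
    · simp [w, o, h]
    · simp [w, o, h, Ne.symm h]
  · intro t; rfl
  · intro L R
    have hb := o_bound L (j+1)
    have e1 : o (j+1) (two L R) = o (j+1) L + o j L + o (j+1) R := rfl
    have e2 : o (j+1+1) (two L R) = o (j+1+1) L + o (j+1) L + o (j+1+1) R := rfl
    have hs : ∀ p : ℕ × ℕ, w j p.1 L * w (j+1) p.2 R =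
        if (o j L = p.1 ∧ o (j+1) L = 0) ∧ (o (j+1) R = p.2 ∧ o (j+1+1) R = 0) then 1 else 0 := by
      intro p
      unfold w
      split_ifs <;> first | omega | simp
    simp only [hs]
    rw [Finset.sum_ite, Finset.sum_const_zero, add_zero, Finset.sum_const, nsmul_one]
    by_cases h : o (j+1) (two L R) = r ∧ o (j+1+1) (two L R) = 0
    · rw [w, if_pos h]
      rw [e1, e2] at h
      have : Finset.filter (fun p : ℕ × ℕ => (o j L = p.1 ∧ o (j+1) L = 0) ∧ (o (j+1) R = p.2 ∧ o (j+1+1) R = 0)) (Finset.HasAntidiagonal.antidiagonal r) = {(o j L, o (j+1) R)} := by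
        ext ⟨a, b⟩
        simp
        omega
      rw [this]; simp
    · rw [w, if_neg h]
      rw [e1, e2] at h
      symm
      rw [Nat.cast_eq_zero, Finset.card_eq_zero]
      ext ⟨a, b⟩
      simp
      omega

theorem A_zero (r : ℕ) : A 0 r = (if r = 0 then 1 else 0) +
    (if r = 0 then 0 else X * (1 + X) * A 0 (r-1)) := by
  conv_lhs => unfold A
  rw [gf_rec {()} (w 0 r) (if r = 0 then 0 else w 0 (r-1))
    (fun _ t => if t = nil then 1 else 0) (fun _ => if r = 0 then 0 else w 0 (r-1))]
  · have h0 : gf (fun t => if t = nil then 1 else 0) = 1 := by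
      ext n
      simp [gf, coeff_one, mem_T, size, eq_comm]
    have h1 : gf 0 = 0 := by ext; simp [gf]
    rw [Finset.sum_singleton, h0]
    by_cases h : r = 0
    · simp [w, o, h, h1]
    · simp [w, o, h, Ne.symm h, A]; ring
  · intro t
    by_cases h : r = 0
    · simp [w, o, h]
    · simp [w, o, h]
      congr 1
      apply propext
      omega
  · intro L R
    have := o_zero_eq_zero L
    have hb := o_bound L 0
    simp only [← this]
    by_cases h : r = 0
    · simp [w, o, h]
    · have e1 : o 0 (two L R) = 1 + o 0 L + o 0 R := rfl
      have e2 : o (0+1) (two L R) = o (0+1) L + o 0 L + o (0+1) R := rfl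
      simp only [w, h, Finset.sum_singleton, if_false]
      split_ifs <;> first | omega | simp

noncomputable def AA (j : ℕ) : PowerSeries (PowerSeries ℚ) := PowerSeries.mk (A j)

theorem AA_succ (j : ℕ) : AA (j+1) = 1 + C X * AA (j+1) + C (X^2) * (AA j * AA (j+1)) := by
  ext1 r
  rw [map_add, map_add, coeff_C_mul, coeff_C_mul, coeff_mul, coeff_one]
  simp only [AA, coeff_mk]
  exact A_succ j r

theorem AA_zero : AA 0 = 1 + X * C (X * (1 + X)) * AA 0 := by
  ext1 r
  simp only [AA, coeff_mk, map_add, coeff_one]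
  rw [A_zero r]
  congr 1
  cases r with
  | zero => simp
  | succ r =>
    rw [mul_assoc (a := (X : PowerSeries (PowerSeries ℚ))), coeff_succ_X_mul, coeff_C_mul]; simp

noncomputable def QQ (j : ℕ) : PowerSeries (PowerSeries ℚ) :=
  C (qcheb (j+1) - X^2 * qcheb j) - X * C (X * (1 + X)) * C (qcheb (j+1))

theorem QQ_rec (j : ℕ) : QQ (j+2) = (1 - C X) * QQ (j+1) - C (X^2) * QQ j := by
  simp only [QQ, qcheb, map_sub, map_mul, map_one, map_add, map_pow]
  ring

theorem QQ_ne (j : ℕ) : QQ j ≠ 0 := by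
  have h : ∀ j, constantCoeff (qcheb (j+1)) = 1 := by
    intro j
    induction j using Nat.strong_induction_on with
    | _ j ih => match j with
      | 0 => simp [qcheb]
      | j+1 => simp [qcheb, ih j (by omega)]
  intro h0
  have := congrArg (fun f => constantCoeff (constantCoeff f)) h0
  simp [QQ, h] at this

theorem AA_QQ_zero : AA 0 * QQ 0 = 1 := by
  have := AA_zero
  simp only [QQ, qcheb, mul_zero, sub_zero, zero_add, map_one, mul_one]
  linear_combination this

theorem AA_QQ_succ (j : ℕ) : AA (j+1) * QQ (j+1) = QQ j := by
  induction j with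
  | zero =>
    have h1 := AA_succ 0
    have h2 := AA_QQ_zero
    have h3 : QQ 1 = (1 - C X) * QQ 0 - C (X^2) := by
      simp only [QQ, qcheb, map_sub, map_mul, map_one, map_add, map_pow, map_zero]
      ring
    rw [zero_add] at *
    rw [h3]
    linear_combination (QQ 0) * h1 + C (X^2) * AA 1 * h2
  | succ j ih =>
    have h1 := AA_succ (j+1)
    rw [show j + 1 + 1 = j + 2 from rfl] at *
    rw [QQ_rec]
    linear_combination (QQ (j+1)) * h1 + C (X^2) * AA (j+2) * ih

theorem qcheb_cassini (j : ℕ) : qcheb (j+1)^2 - qcheb j * qcheb (j+2) = X^(2*j) := by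
  induction j with
  | zero => simp [qcheb]
  | succ j ih =>
    rw [show 2 * (j+1) = 2 * j + 2 by ring, pow_add, ← ih]
    simp only [qcheb]
    ring

/- final algebra -/
theorem A_final_zero (j : ℕ) : A (j+1) 0 * (qcheb (j+2) - X^2 * qcheb (j+1)) =
    qcheb (j+1) - X^2 * qcheb j := by
  have := congrArg (coeff 0) (AA_QQ_succ j)
  simpa [AA, QQ] using this

theorem A_coeff_succ (j r : ℕ) : A (j+1) (r+1) * (qcheb (j+2) - X^2 * qcheb (j+1))
    - A (j+1) r * (X * (1+X) * qcheb (j+2)) =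
    if r = 0 then - (X * (1+X) * qcheb (j+1)) else 0 := by
  have := congrArg (coeff (r+1)) (AA_QQ_succ j)
  have e : AA (j+1) * QQ (j+1) = AA (j+1) * C (qcheb (j+2) - X^2 * qcheb (j+1)) -
      X * (AA (j+1) * C (X * (1+X) * qcheb (j+2))) := by
    rw [QQ, map_mul C (X * (1+X))]; ring
  have e' : QQ j = C (qcheb (j+1) - X^2 * qcheb j) - X * C (X * (1+X) * qcheb (j+1)) := by
    rw [QQ, map_mul C (X * (1+X))]; ring
  rw [e, e', map_sub (coeff (r+1)), map_sub (coeff (r+1)), coeff_succ_X_mul, coeff_succ_X_mul,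
    coeff_mul_C, coeff_mul_C, coeff_C, coeff_C, if_neg (by omega)] at this
  simp only [AA, coeff_mk] at this
  rw [this]
  split_ifs <;> simp

theorem A_final (j r : ℕ) : A (j+1) (r+1) * (qcheb (j+2) - X^2 * qcheb (j+1))^(r+2) =
    X^(2*j+2+(r+1)) * (1+X)^(r+1) * qcheb (j+2)^r := by
  induction r with
  | zero =>
    have h1 := A_coeff_succ j 0
    have h0 := A_final_zero j
    have h2 := qcheb_cassini j
    simp only [if_true, zero_add] at h1 ⊢
    rw [show 2 * j + 2 + 1 = 2 * j + 3 by ring, pow_add, ← h2]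
    linear_combination (qcheb (j+2) - X^2 * qcheb (j+1)) * h1 + (X * (1+X) * qcheb (j+2)) * h0
  | succ r ih =>
    have h1 := A_coeff_succ j (r+1)
    rw [if_neg (by omega)] at h1
    linear_combination (qcheb (j+2) - X^2 * qcheb (j+1))^(r+2) * h1 + (X * (1+X) * qcheb (j+2)) * ih

theorem coeff_A (j r : ℕ) (hr : r ≤ j + 1) : A j r =
    PowerSeries.mk fun n => (Nat.card {t : MT // size t = n ∧ o j t = r} : ℚ) := by
  ext n
  simp only [A, gf, w, coeff_mk]
  rw [← Finset.sum_filter, Finset.sum_const, nsmul_one]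
  congr 1
  rw [← Nat.card_eq_finsetCard]
  refine Nat.card_congr (Equiv.subtypeEquivRight fun t => ?_)
  have := o_bound t j
  rw [Finset.mem_filter, mem_T]
  omega

end MT
/-- increasing subsequences of length `j` in `l` with all entries above `a` -/
def linc : ℕ → ℕ → List ℕ → ℕ
  | 0, _, _ => 1
  | _+1, _, [] => 0
  | j+1, a, b :: l => linc (j+1) a l + if a < b then linc j b l else 0

def locc (j : ℕ) : List ℕ → ℕ
  | [] => 0
  | a :: l => locc j l + if (∀ b ∈ l.head?, b < a) then linc j a l else 0

def L132 : List ℕ → Prop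
  | [] => True
  | a :: l => l.Pairwise (fun b c => ¬ (a < c ∧ c < b)) ∧ L132 l

def L123 : List ℕ → Prop
  | [] => True
  | a :: l => l.IsChain (fun b c => ¬ (a < b ∧ b < c)) ∧ L123 l

/-- `l` is an arrangement of the interval `[s, s + length l)`. -/
def Arr (s : ℕ) (l : List ℕ) : Prop := l.Nodup ∧ ∀ x, x ∈ l ↔ s ≤ x ∧ x < s + l.length

theorem linc_small (j a : ℕ) (R : List ℕ) (h : ∀ x ∈ R, x ≤ a) : linc j a R = linc j a [] := by
  cases j with
  | zero => simp [linc]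
  | succ j =>
    induction R with
    | nil => rfl
    | cons b R ih =>
      have h1 := h b (by simp)
      rw [linc.eq_3, ih (fun x hx => h x (by simp [hx])), if_neg (by omega), add_zero]

theorem linc_append (a m M : ℕ) (R : List ℕ) (hm : m ≤ a) (hM : a < M) (hR : ∀ x ∈ R, x ≤ a)
    (L : List ℕ) (hL : ∀ x ∈ L, m < x ∧ x < M) :
    ∀ j, linc (j+1) a (L ++ m :: M :: R) = linc (j+1) a L + linc j a L := by
  induction L generalizing a with
  | nil =>
    intro j
    have h1 := linc_small (j+1) a R hR
    have h2 := linc_small j M R (fun x hx => by have := hR x hx; omega)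
    have : linc j M [] = linc j a [] := by cases j <;> simp [linc]
    rw [List.nil_append, linc.eq_3, if_neg (by omega : ¬ a < m), linc.eq_3, if_pos hM, h1, h2, this]
    omega
  | cons b L ih =>
    intro j
    have hb := hL b (by simp)
    have hL' : ∀ x ∈ L, m < x ∧ x < M := fun x hx => hL x (by simp [hx])
    rw [List.cons_append, linc, ih a hm hM hR hL' j, linc]
    by_cases hab : a < b
    · rw [if_pos hab, if_pos hab]
      cases j with
      | zero => simp [linc]
      | succ j =>
        rw [ih b (by omega) hb.2 (fun x hx => by have := hR x hx; omega) hL' j]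
        rw [linc.eq_3 a j, if_pos hab]; omega
    · rw [if_neg hab, if_neg hab]
      cases j with
      | zero => simp [linc]
      | succ j => rw [linc.eq_3 a j, if_neg hab]; omega

theorem locc_one (j M : ℕ) (R : List ℕ) (h : ∀ x ∈ R, x < M) :
    locc j (M :: R) = locc j R + if j = 0 then 1 else 0 := by
  rw [locc, if_pos, linc_small j M R (fun x hx => (h x hx).le)]
  · cases j <;> simp [linc]
  · intro b hb; exact h b (List.mem_of_mem_head? hb)

theorem locc_two_zero (m M : ℕ) (R L : List ℕ) (hmM : m < M) (hR : ∀ x ∈ R, x < m)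
    (hL : ∀ x ∈ L, m < x ∧ x < M) :
    locc 0 (L ++ m :: M :: R) = 1 + locc 0 L + locc 0 R := by
  induction L with
  | nil =>
    have hn : ¬ ∀ b ∈ (M :: R).head?, b < m := by simpa using hmM.le
    rw [List.nil_append, locc.eq_2 _ m, locc_one _ _ _ (fun x hx => (hR x hx).trans hmM), if_neg hn]
    simp [locc]; omega
  | cons a L ih =>
    have ha := hL a (by simp)
    have := ih (fun x hx => hL x (by simp [hx]))
    rw [List.cons_append, locc, this, locc]
    have : (∀ b ∈ (L ++ m :: M :: R).head?, b < a) ↔ ∀ b ∈ L.head?, b < a := by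
      cases L <;> simp [ha]
    simp only [this, linc]
    omega

theorem locc_two_succ (j m M : ℕ) (R L : List ℕ) (hmM : m < M) (hR : ∀ x ∈ R, x < m)
    (hL : ∀ x ∈ L, m < x ∧ x < M) :
    locc (j+1) (L ++ m :: M :: R) = locc (j+1) L + locc j L + locc (j+1) R := by
  induction L with
  | nil =>
    have hn : ¬ ∀ b ∈ (M :: R).head?, b < m := by simpa using hmM.le
    rw [List.nil_append, locc.eq_2 _ m, locc_one _ _ _ (fun x hx => (hR x hx).trans hmM), if_neg hn]
    simp [locc]
  | cons a L ih =>
    have ha := hL a (by simp)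
    have hL' : ∀ x ∈ L, m < x ∧ x < M := fun x hx => hL x (by simp [hx])
    have := ih hL'
    rw [List.cons_append, locc, this, locc, locc]
    have : (∀ b ∈ (L ++ m :: M :: R).head?, b < a) ↔ ∀ b ∈ L.head?, b < a := by
      cases L <;> simp [ha]
    simp only [this]
    rw [linc_append a m M R ha.1.le ha.2 (fun x hx => by have := hR x hx; omega) L hL' j]
    split_ifs <;> omega

theorem arr_split (s : ℕ) (A B : List ℕ) (h : Arr s (A ++ B)) (hAB : ∀ a ∈ A, ∀ b ∈ B, b < a) :
    Arr s B ∧ Arr (s + B.length) A := by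
  obtain ⟨hn, hm⟩ := h
  rw [List.nodup_append] at hn
  obtain ⟨hA, hB, hd⟩ := hn
  have hcB : B.toFinset.card = B.length := List.toFinset_card_of_nodup hB
  have hcA : A.toFinset.card = A.length := List.toFinset_card_of_nodup hA
  have h1 : B.toFinset = Finset.Ico s (s + B.length) := by
    apply Finset.eq_of_subset_of_card_le
    · intro x hx
      rw [List.mem_toFinset] at hx
      have hx' := (hm x).1 (by simp [hx])
      have : Finset.Ico s (x+1) ⊆ B.toFinset := by
        intro y hy
        rw [Finset.mem_Ico] at hy
        rw [List.mem_toFinset]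
        have := (hm y).2 ⟨hy.1, by omega⟩
        rcases List.mem_append.1 this with h | h
        · have := hAB y h x hx; omega
        · exact h
      have := Finset.card_le_card this
      rw [Nat.card_Ico, hcB] at this
      rw [Finset.mem_Ico]; omega
    · rw [Nat.card_Ico, hcB]; omega
  have hB' : ∀ x, x ∈ B ↔ s ≤ x ∧ x < s + B.length := by
    intro x; rw [← List.mem_toFinset, h1, Finset.mem_Ico]
  refine ⟨⟨hB, hB'⟩, hA, fun x => ?_⟩
  have e1 := hm x
  have e2 := hB' x
  rw [List.mem_append, List.length_append] at e1
  constructor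
  · intro hx
    have : x ∉ B := fun h => hd x hx x h rfl
    have := e1.1 (Or.inl hx)
    have := mt e2.2 ‹x ∉ B›
    omega
  · intro hx
    have := e1.2 (by omega)
    rcases this with h | h
    · exact h
    · have := e2.1 h; omega

theorem arr_join (s : ℕ) (A B : List ℕ) (hB : Arr s B) (hA : Arr (s + B.length) A) :
    Arr s (A ++ B) := by
  refine ⟨List.nodup_append.2 ⟨hA.1, hB.1, ?_⟩, fun x => ?_⟩
  · intro a ha b hb
    have := (hA.2 a).1 ha
    have := (hB.2 b).1 hb
    omega
  · rw [List.mem_append, List.length_append, hA.2, hB.2]; omega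

theorem arr_single (s : ℕ) : Arr s [s] := by
  refine ⟨by simp, fun x => ?_⟩
  simp; omega

theorem L132_append (A B : List ℕ) : L132 (A ++ B) ↔
    L132 A ∧ L132 B ∧ (∀ a ∈ A, B.Pairwise (fun b c => ¬ (a < c ∧ c < b))) ∧
      (A.Pairwise (fun a b => ∀ c ∈ B, ¬ (a < c ∧ c < b))) := by
  induction A with
  | nil => simp [L132]
  | cons a A ih =>
    simp only [List.cons_append, L132, ih, List.pairwise_append, List.pairwise_cons,
      List.forall_mem_cons]
    tauto

theorem L123_append_mid (A : List ℕ) (m M : ℕ) (R : List ℕ) : L123 (A ++ m :: M :: R) ↔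
    L123 (A ++ [m]) ∧ L123 (m :: M :: R) ∧ ∀ a ∈ A, (m :: M :: R).IsChain (fun b c => ¬ (a < b ∧ b < c)) := by
  induction A with
  | nil => simp [L123]
  | cons a A ih =>
    have := List.isChain_split (R := fun b c => ¬ (a < b ∧ b < c)) (l₁ := A) (l₂ := M :: R) (c := m)
    simp only [List.cons_append, L123, List.forall_mem_cons] at *
    rw [ih, this]
    tauto

namespace MT

def toL : MT → ℕ → List ℕ
  | nil, _ => []
  | one R, s => (s + size R) :: toL R s
  | two L R, s => toL L (s + size R + 1) ++ (s + size R) :: (s + size R + 1 + size L) :: toL R s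

theorem length_toL (t : MT) : ∀ s, (toL t s).length = size t := by
  induction t with
  | nil => simp [toL, size]
  | one R ih => simp [toL, size, ih]
  | two L R ih1 ih2 => simp [toL, size, ih1, ih2]; omega

theorem arr_toL (t : MT) : ∀ s, Arr s (toL t s) := by
  induction t with
  | nil => intro s; simp [toL, Arr]
  | one R ih =>
    intro s
    have h := arr_single (s + size R)
    rw [toL]
    have := arr_join s [s + size R] (toL R s) (ih s) (by rw [length_toL]; exact h)
    simpa using this
  | two L R ih1 ih2 =>
    intro s
    have hR := ih2 s
    have hL := ih1 (s + size R + 1)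
    have lL := length_toL L (s + size R + 1)
    have lR := length_toL R s
    rw [toL]
    refine ⟨?_, fun x => ?_⟩
    · simp only [List.nodup_append, List.nodup_cons, List.mem_cons, hR.2, hL.2, hL.1, hR.1, lL, lR]
      refine ⟨trivial, ⟨by omega, by omega, trivial⟩, ?_⟩
      intro a ha b hb
      omega
    · simp only [List.mem_append, List.mem_cons, hR.2, hL.2, List.length_append, List.length_cons, lL, lR]
      omega

theorem locc_toL (t : MT) : ∀ j s, locc j (toL t s) = o j t := by
  induction t with
  | nil => intro j s; simp [toL, locc, o]
  | one R ih =>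
    intro j s
    have hR := (arr_toL R s).2
    have lR := length_toL R s
    rw [toL, locc_one _ _ _ (fun x hx => by have := (hR x).1 hx; omega), ih]
    cases j <;> simp [o]; omega
  | two L R ih1 ih2 =>
    intro j s
    have hR := (arr_toL R s).2
    have lR := length_toL R s
    have hL := (arr_toL L (s + size R + 1)).2
    have lL := length_toL L (s + size R + 1)
    have a1 : ∀ x ∈ toL R s, x < s + size R := fun x hx => by have := (hR x).1 hx; omega
    have a2 : ∀ x ∈ toL L (s + size R + 1), s + size R < x ∧ x < s + size R + 1 + size L :=
      fun x hx => by have := (hL x).1 hx; omega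
    cases j with
    | zero => rw [toL, locc_two_zero _ _ _ _ (by omega) a1 a2, ih1, ih2, o]
    | succ j => rw [toL, locc_two_succ _ _ _ _ _ (by omega) a1 a2, ih1, ih1, ih2, o]

theorem pairwise_of_small (a : ℕ) (R : List ℕ) (h : ∀ x ∈ R, x ≤ a) :
    R.Pairwise (fun b c => ¬ (a < c ∧ c < b)) := by
  apply List.pairwise_of_forall_mem_list
  · intro b hb c hc hh
    have := h c hc; omega

theorem isChain_of_small (a : ℕ) (R : List ℕ) (h : ∀ x ∈ R, x ≤ a) :
    R.IsChain (fun b c => ¬ (a < b ∧ b < c)) := by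
  apply List.Pairwise.isChain
  apply List.pairwise_of_forall_mem_list
  · intro b hb c hc hh
    have := h b hb; omega

theorem L132_toL (t : MT) : ∀ s, L132 (toL t s) := by
  induction t with
  | nil => intro s; simp [toL, L132]
  | one R ih =>
    intro s
    have hR := (arr_toL R s).2
    have lR := length_toL R s
    rw [toL, L132]
    exact ⟨pairwise_of_small _ _ (fun x hx => by have := (hR x).1 hx; omega), ih s⟩
  | two L R ih1 ih2 =>
    intro s
    have hR := (arr_toL R s).2
    have lR := length_toL R s
    have hL := (arr_toL L (s + size R + 1)).2
    have lL := length_toL L (s + size R + 1)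
    have a1 : ∀ x ∈ toL R s, x < s + size R := fun x hx => by have := (hR x).1 hx; omega
    have a2 : ∀ x ∈ toL L (s + size R + 1), s + size R < x ∧ x < s + size R + 1 + size L :=
      fun x hx => by have := (hL x).1 hx; omega
    have key : ∀ a, s + size R ≤ a → (toL R s).Pairwise (fun b c => ¬ (a < c ∧ c < b)) :=
      fun a ha => pairwise_of_small _ _ (fun x hx => by have := a1 x hx; omega)
    rw [toL, L132_append]
    refine ⟨ih1 _, ?_, ?_, ?_⟩
    · refine ⟨List.pairwise_cons.2 ⟨?_, key _ le_rfl⟩, key _ (by omega), ih2 s⟩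
      intro c hc hh
      have := a1 c hc; omega
    · intro a ha
      have := a2 a ha
      refine List.pairwise_cons.2 ⟨?_, List.pairwise_cons.2 ⟨?_, key _ (by omega)⟩⟩
      · intro c hc hh
        rcases List.mem_cons.1 hc with rfl | hc
        · omega
        · have := a1 c hc; omega
      · intro c hc hh
        have := a1 c hc; omega
    · apply List.pairwise_of_forall_mem_list
      · intro b hb c hc d hd hh
        have := a2 b hb
        have := a2 c hc
        rcases List.mem_cons.1 hd with rfl | hd
        · omega
        rcases List.mem_cons.1 hd with rfl | hd
        · omega
        · have := a1 d hd; omega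

theorem L123_concat (A : List ℕ) (m : ℕ) (h : L123 A) (hm : ∀ a ∈ A, m < a) : L123 (A ++ [m]) := by
  induction A with
  | nil => simp [L123]
  | cons a A ih =>
    rw [List.cons_append, L123]
    refine ⟨?_, ih h.2 (fun x hx => hm x (by simp [hx]))⟩
    rw [List.isChain_append]
    refine ⟨h.1, by simp, ?_⟩
    intro x hx y hy hh
    simp at hy
    subst hy
    have := hm a (by simp)
    omega

theorem L123_toL (t : MT) : ∀ s, L123 (toL t s) := by
  induction t with
  | nil => intro s; simp [toL, L123]
  | one R ih =>
    intro s
    have hR := (arr_toL R s).2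
    have lR := length_toL R s
    rw [toL, L123]
    exact ⟨isChain_of_small _ _ (fun x hx => by have := (hR x).1 hx; omega), ih s⟩
  | two L R ih1 ih2 =>
    intro s
    have hR := (arr_toL R s).2
    have lR := length_toL R s
    have hL := (arr_toL L (s + size R + 1)).2
    have lL := length_toL L (s + size R + 1)
    have a1 : ∀ x ∈ toL R s, x < s + size R := fun x hx => by have := (hR x).1 hx; omega
    have a2 : ∀ x ∈ toL L (s + size R + 1), s + size R < x ∧ x < s + size R + 1 + size L :=
      fun x hx => by have := (hL x).1 hx; omega
    have key : ∀ a, s + size R ≤ a → (toL R s).IsChain (fun b c => ¬ (a < b ∧ b < c)) :=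
      fun a ha => isChain_of_small _ _ (fun x hx => by have := a1 x hx; omega)
    have key2 : ∀ a, s + size R ≤ a → ((s + size R + 1 + size L) :: toL R s).IsChain (fun b c => ¬ (a < b ∧ b < c)) := by
      intro a ha
      rw [List.isChain_cons]
      refine ⟨?_, key a ha⟩
      intro y hy hh
      have := a1 y (List.mem_of_mem_head? hy); omega
    rw [toL, L123_append_mid]
    refine ⟨L123_concat _ _ (ih1 _) (fun x hx => (a2 x hx).1), ⟨key2 _ le_rfl, key _ (by omega), ih2 s⟩, ?_⟩
    intro a ha
    have := a2 a ha
    rw [List.isChain_cons_cons]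
    exact ⟨by omega, key2 _ (by omega)⟩

theorem append_max_inj {A B A' B' : List ℕ} {M : ℕ} (h : A ++ M :: B = A' ++ M :: B')
    (h1 : M ∉ A) (h2 : M ∉ A') : A = A' ∧ B = B' := by
  induction A generalizing A' with
  | nil =>
    cases A' with
    | nil => simpa using h
    | cons c A' => simp at h h2; omega
  | cons a A ih =>
    cases A' with
    | nil => simp at h h1; omega
    | cons c A' =>
      simp at h h1 h2
      have := ih h.2 h1.2 h2.2
      simp [h.1, this]

theorem toL_inj (t : MT) : ∀ s t', toL t s = toL t' s → t = t' := by
  induction t with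
  | nil =>
    intro s t' h
    have := congrArg List.length h
    rw [length_toL, length_toL] at this
    cases t' <;> simp [size] at this ⊢
  | one R ih =>
    intro s t' h
    have hl := congrArg List.length h
    rw [length_toL, length_toL] at hl
    cases t' with
    | nil => simp [size] at hl
    | one R' =>
      simp only [toL, List.cons.injEq] at h
      rw [ih s R' h.2]
    | two L' R' =>
      exfalso
      simp only [size] at hl
      have l1 := length_toL L' (s + size R' + 1)
      have m1 := (arr_toL L' (s + size R' + 1)).2
      simp only [toL] at h
      generalize toL L' (s + size R' + 1) = Z at h l1 m1
      cases Z with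
      | nil => simp at h l1; omega
      | cons z Z =>
        simp at h
        have := (m1 z).1 (by simp)
        simp only [l1] at this
        omega
  | two L R ih1 ih2 =>
    intro s t' h
    have hl := congrArg List.length h
    rw [length_toL, length_toL] at hl
    cases t' with
    | nil => simp [size] at hl
    | one R' =>
      exfalso
      simp only [size] at hl
      have l1 := length_toL L (s + size R + 1)
      have m1 := (arr_toL L (s + size R + 1)).2
      simp only [toL] at h
      generalize toL L (s + size R + 1) = Z at h l1 m1
      cases Z with
      | nil => simp at h l1; omega
      | cons z Z =>
        simp at h
        have := (m1 z).1 (by simp)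
        simp only [l1] at this
        omega
    | two L' R' =>
      have l1 := length_toL L (s + size R + 1)
      have m1 := (arr_toL L (s + size R + 1)).2
      have l2 := length_toL L' (s + size R' + 1)
      have m2 := (arr_toL L' (s + size R' + 1)).2
      simp only [size] at hl
      simp only [toL] at h
      rw [show s + size R' + 1 + size L' = s + size R + 1 + size L by omega] at h
      rw [List.append_cons, List.append_cons (as := toL L' _)] at h
      have := append_max_inj h (by simp [m1, l1]; omega) (by simp [m2, l2]; omega)
      obtain ⟨h1, h2⟩ := this
      have h3 := ih2 s R' h2
      subst h3
      have h4 := List.append_cancel_right h1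
      rw [ih1 _ _ h4]

theorem toL_surj : ∀ (n s : ℕ) (l : List ℕ), l.length = n → Arr s l → L132 l → L123 l →
    ∃ t, toL t s = l := by
  intro n
  induction n using Nat.strong_induction_on with
  | _ n ih =>
  intro s l hl ha h1 h2
  cases n with
  | zero => exact ⟨nil, by simp [toL, List.length_eq_zero_iff.1 hl]⟩
  | succ n =>
  have hmem : s + n ∈ l := (ha.2 _).2 (by omega)
  obtain ⟨P, Q, rfl⟩ := List.append_of_mem hmem
  have hnd := ha.1
  rw [List.length_append, List.length_cons] at hl
  have hmx := fun x => (ha.2 x).1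
  rw [List.length_append, List.length_cons] at hmx
  have hPQ : ∀ a ∈ P, ∀ b ∈ Q, b < a := by
    intro a haP b hbQ
    have h3 := ((L132_append _ _).1 h1).2.2.1 a haP
    have h4 := (List.pairwise_cons.1 h3).1 b hbQ
    have h5 := hmx b (by simp [hbQ])
    have h6 : a ≠ b := (List.nodup_append.1 hnd).2.2 a haP b (by simp [hbQ])
    have h7 : b ≠ s + n := by
      rintro rfl
      have := (List.nodup_append.1 hnd).2.1
      simp at this; exact this.1 hbQ
    omega
  have hMQ : ∀ b ∈ Q, b < s + n := by
    intro b hbQ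
    have h5 := hmx b (by simp [hbQ])
    have h7 : b ≠ s + n := by
      rintro rfl
      have := (List.nodup_append.1 hnd).2.1
      simp at this; exact this.1 hbQ
    omega
  have hPM : ∀ b ∈ P, b < s + n := by
    intro b hbP
    have h5 := hmx b (by simp [hbP])
    have h6 : b ≠ s + n := (List.nodup_append.1 hnd).2.2 b hbP _ (by simp)
    omega
  have e := arr_split s (P ++ [s+n]) Q (by simpa using ha) (by
    intro a ha b hb
    rcases List.mem_append.1 ha with h | h
    · exact hPQ a h b hb
    · simp at h; subst h; exact hMQ b hb)
  have h1Q : L132 Q := ((L132_append _ _).1 h1).2.1.2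
  rcases List.eq_nil_or_concat P with rfl | ⟨L, m, rfl⟩
  · simp at hl
    obtain ⟨R, hR⟩ := ih n (by omega) s Q (by omega) e.1 h1Q h2.2
    refine ⟨one R, ?_⟩
    have := length_toL R s
    rw [toL, hR, ← this, hR, hl]; rfl
  · rw [List.concat_eq_append] at *
    rw [List.append_assoc, List.singleton_append] at h1 h2 hnd
    have h2' := (L123_append_mid _ _ _ _).1 h2
    have hLm : ∀ a ∈ L, m < a := by
      intro a haL
      have h3 := h2'.2.2 a haL
      rw [List.isChain_cons_cons] at h3
      have h4 := hPM m (by simp)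
      have h5 : a ≠ m := (List.nodup_append.1 hnd).2.2 a haL _ (by simp)
      omega
    have hQm : ∀ b ∈ Q, b < m := hPQ m (by simp)
    simp at hl
    -- split off
    obtain ⟨R, hR⟩ := ih Q.length (by omega) s Q rfl e.1 h1Q h2'.2.1.2.2
    have hsz : size R = Q.length := by rw [← length_toL R s, hR]
    have e2 : Arr (s + Q.length) (L ++ [m]) := by
      refine ⟨?_, fun x => ?_⟩
      · exact (List.nodup_append.1 e.2.1).1
      · have := e.2.2 x
        have hh := hPM x
        rw [List.mem_append, List.length_append, List.length_append] at this
        rw [List.length_append]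
        simp only [List.length_singleton, List.mem_singleton] at this ⊢
        constructor
        · intro hx
          have := hh hx; have := ‹(_ ∨ _) ↔ _›.1 (Or.inl hx); omega
        · intro hx
          rcases this.2 (by omega) with h | h
          · exact h
          · omega
    have e3 := arr_split _ _ _ e2 (by simpa using hLm)
    have hm : m = s + Q.length := by
      have := (e3.1.2 m).1 (by simp)
      simp at this; omega
    have h1L : L132 L := ((L132_append _ _).1 h1).1
    have h2L : L123 L := by
      have := h2'.1
      clear * - this
      induction L with
      | nil => simp [L123]
      | cons a L ih =>
        rw [List.cons_append, L123, List.isChain_append] at this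
        exact ⟨this.1.1, ih this.2⟩
    obtain ⟨L', hL'⟩ := ih L.length (by omega) (s + Q.length + 1) L rfl (by simpa using e3.2) h1L h2L
    have hsz2 : size L' = L.length := by rw [← length_toL L', hL']
    refine ⟨two L' R, ?_⟩
    rw [toL, hR, hsz, hsz2, hL', hm, List.append_assoc, List.singleton_append]
    congr 3
    omega

end MT
theorem L132_ofFn : ∀ {n : ℕ} (f : Fin n → ℕ), L132 (List.ofFn f) ↔
    ¬ ∃ i j k : Fin n, i < j ∧ j < k ∧ f i < f k ∧ f k < f j := by
  intro n
  induction n with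
  | zero => intro f; simp [L132]
  | succ n ih =>
    intro f
    rw [List.ofFn_succ, L132, ih, List.pairwise_ofFn]
    constructor
    · rintro ⟨h1, h2⟩ ⟨i, j, k, hij, hjk, h⟩
      obtain ⟨j, rfl⟩ := Fin.exists_succ_eq.2 (Fin.pos_iff_ne_zero.1 (lt_of_le_of_lt (Fin.zero_le i) hij))
      obtain ⟨k, rfl⟩ := Fin.exists_succ_eq.2 (Fin.pos_iff_ne_zero.1 (lt_of_le_of_lt (Fin.zero_le _) hjk))
      have hjk' := Fin.succ_lt_succ_iff.1 hjk
      rcases Fin.eq_zero_or_eq_succ i with rfl | ⟨i, rfl⟩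
      · exact h1 hjk' h
      · exact h2 ⟨i, j, k, Fin.succ_lt_succ_iff.1 hij, hjk', h⟩
    · intro h
      refine ⟨fun j k hjk hh => h ⟨0, j.succ, k.succ, Fin.succ_pos _, Fin.succ_lt_succ_iff.2 hjk, hh⟩, ?_⟩
      rintro ⟨i, j, k, hij, hjk, hh⟩
      exact h ⟨i.succ, j.succ, k.succ, Fin.succ_lt_succ_iff.2 hij, Fin.succ_lt_succ_iff.2 hjk, hh⟩

theorem L123_ofFn : ∀ {n : ℕ} (f : Fin n → ℕ), L123 (List.ofFn f) ↔
    ¬ ∃ (a b : Fin n) (h : (b : ℕ) + 1 < n), a < b ∧ f a < f b ∧ f b < f ⟨(b : ℕ) + 1, h⟩ := by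
  intro n
  induction n with
  | zero => intro f; simp [L123]
  | succ n ih =>
    intro f
    rw [List.ofFn_succ, L123, ih, List.isChain_iff_getElem]
    simp only [List.length_ofFn, List.getElem_ofFn]
    constructor
    · rintro ⟨h1, h2⟩ ⟨a, b, hb, hab, h⟩
      obtain ⟨b, rfl⟩ := Fin.exists_succ_eq.2 (Fin.pos_iff_ne_zero.1 (lt_of_le_of_lt (Fin.zero_le a) hab))
      have hb' : (b : ℕ) + 1 < n := by simpa using hb
      rcases Fin.eq_zero_or_eq_succ a with rfl | ⟨a, rfl⟩
      · exact h1 b hb' h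
      · exact h2 ⟨a, b, hb', Fin.succ_lt_succ_iff.1 hab, h⟩
    · intro h
      refine ⟨fun b hb hh => h ⟨0, Fin.succ ⟨b, by omega⟩, by simpa using hb, Fin.succ_pos _, hh⟩, ?_⟩
      rintro ⟨a, b, hb, hab, hh⟩
      exact h ⟨a.succ, b.succ, by simpa using hb, Fin.succ_lt_succ_iff.2 hab, hh⟩

theorem strictMono_cons_iff {j : ℕ} {α : Type*} [Preorder α] (x : α) (g : Fin j → α) :
    StrictMono (Fin.cons x g : Fin (j+1) → α) ↔ (∀ i, x < g i) ∧ StrictMono g := by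
  constructor
  · intro h
    refine ⟨fun i => ?_, fun a b hab => ?_⟩
    · simpa using h (Fin.succ_pos i)
    · simpa using h (Fin.succ_lt_succ_iff.2 hab)
  · rintro ⟨h1, h2⟩ a b hab
    obtain ⟨b, rfl⟩ := Fin.exists_succ_eq.2 (Fin.pos_iff_ne_zero.1 (lt_of_le_of_lt (Fin.zero_le a) hab))
    rcases Fin.eq_zero_or_eq_succ a with rfl | ⟨a, rfl⟩
    · simpa using h1 b
    · simpa using h2 (Fin.succ_lt_succ_iff.1 hab)

def IncP {j n : ℕ} (a : ℕ) (f : Fin n → ℕ) (g : Fin j → Fin n) : Prop :=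
  StrictMono g ∧ (∀ i, a < f (g i)) ∧ StrictMono fun i => f (g i)

/-- a map to `Fin (n+1)` avoiding `0` -/
theorem exists_succ_comp {j n : ℕ} (g : Fin j → Fin (n+1)) (h : ∀ i, 0 < g i) :
    ∃ g' : Fin j → Fin n, g = fun i => (g' i).succ := by
  refine ⟨fun i => (g i).pred (Fin.pos_iff_ne_zero.1 (h i)), ?_⟩
  ext i; simp

theorem strictMono_succ_comp {j n : ℕ} (g : Fin j → Fin n) :
    StrictMono (fun i => (g i).succ) ↔ StrictMono g :=
  ⟨fun h a b hab => Fin.succ_lt_succ_iff.1 (h hab), fun h a b hab => Fin.succ_lt_succ_iff.2 (h hab)⟩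

theorem card_inc : ∀ (n j a : ℕ) (f : Fin n → ℕ),
    Nat.card {g : Fin j → Fin n // IncP a f g} = linc j a (List.ofFn f) := by
  intro n
  induction n with
  | zero =>
    intro j a f
    cases j with
    | zero =>
      simp only [linc]
      rw [Nat.card_eq_one_iff_unique]
      refine ⟨⟨fun x y => Subtype.ext (Subsingleton.elim _ _)⟩, ⟨⟨fun i => i, ?_, ?_, ?_⟩⟩⟩
      · intro i; exact i.elim0
      · intro i; exact i.elim0
      · intro i; exact i.elim0
    | succ j =>
      simp only [List.ofFn_zero, linc]
      rw [Nat.card_eq_zero]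
      left
      exact ⟨fun g => (g.1 0).elim0⟩
  | succ n ih =>
    intro j a f
    cases j with
    | zero =>
      simp only [linc]
      rw [Nat.card_eq_one_iff_unique]
      refine ⟨⟨fun x y => Subtype.ext (Subsingleton.elim _ _)⟩, ⟨⟨fun i => i.elim0, ?_, ?_, ?_⟩⟩⟩
      · intro i; exact i.elim0
      · intro i; exact i.elim0
      · intro i; exact i.elim0
    | succ j =>
      rw [List.ofFn_succ, linc, ← ih, ← ih]
      have hsplit : (if a < f 0 then Nat.card {g : Fin j → Fin n // IncP (f 0) (fun i => f i.succ) g} else 0)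
          = Nat.card {g : Fin j → Fin n // a < f 0 ∧ IncP (f 0) (fun i => f i.succ) g} := by
        split_ifs with h
        · simp [h]
        · symm; rw [Nat.card_eq_zero]; left; exact ⟨fun g => h g.2.1⟩
      rw [hsplit, ← Nat.card_sum]
      symm
      refine Nat.card_congr (Equiv.ofBijective
        (fun x : {g : Fin (j+1) → Fin n // IncP a (fun i => f i.succ) g} ⊕
            {g : Fin j → Fin n // a < f 0 ∧ IncP (f 0) (fun i => f i.succ) g} =>
          (match x with
          | Sum.inl g => ⟨fun i => (g.1 i).succ, (strictMono_succ_comp _).2 g.2.1, g.2.2.1, g.2.2.2⟩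
          | Sum.inr g => ⟨Fin.cons 0 (fun i => (g.1 i).succ), ?_⟩ :
            {g : Fin (j+1) → Fin (n+1) // IncP a f g})) ⟨?_, ?_⟩)
      · obtain ⟨g, h0, h1, h2, h3⟩ := g
        refine ⟨?_, ?_, ?_⟩
        · rw [strictMono_cons_iff]
          exact ⟨fun i => Fin.succ_pos _, (strictMono_succ_comp _).2 h1⟩
        · intro i
          rcases Fin.eq_zero_or_eq_succ i with rfl | ⟨i, rfl⟩
          · simpa using h0
          · simpa using h0.trans (h2 i)
        · have : (fun i => f ((Fin.cons 0 (fun i => (g i).succ) : Fin (j+1) → Fin (n+1)) i)) =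
              (Fin.cons (f 0) (fun i => f (g i).succ) : Fin (j+1) → ℕ) := by
            ext i
            rcases Fin.eq_zero_or_eq_succ i with rfl | ⟨i, rfl⟩ <;> simp
          rw [this, strictMono_cons_iff]
          exact ⟨h2, h3⟩
      · rintro (⟨g, hg⟩ | ⟨g, hg⟩) (⟨g', hg'⟩ | ⟨g', hg'⟩) h
        · replace h := congrArg Subtype.val h
          dsimp only at h
          congr 2
          ext i
          have := congrFun h i
          simpa [Fin.ext_iff] using this
        · replace h := congrArg Subtype.val h
          dsimp only at h
          have := congrFun h 0
          simp at this
        · replace h := congrArg Subtype.val h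
          dsimp only at h
          have := congrFun h 0
          simp at this
          exact absurd this.symm (Fin.succ_ne_zero _)
        · replace h := congrArg Subtype.val h
          dsimp only at h
          congr 2
          ext i
          have := congrFun h i.succ
          simpa [Fin.ext_iff] using this
      · rintro ⟨g, h1, h2, h3⟩
        by_cases h0 : g 0 = 0
        · obtain ⟨g', hg'⟩ := exists_succ_comp (fun i => g (Fin.succ i))
            (fun i => by rw [← h0]; exact h1 (Fin.succ_pos i))
          have hg : g = Fin.cons 0 (fun i => (g' i).succ) := by
            ext1 i
            rcases Fin.eq_zero_or_eq_succ i with rfl | ⟨i, rfl⟩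
            · simpa using h0
            · simpa using congrFun hg' i
          refine ⟨Sum.inr ⟨g', ?_, ?_, ?_, ?_⟩, ?_⟩
          · rw [← h0]; exact h2 0
          · rw [← strictMono_succ_comp, ← hg']
            exact fun x y hxy => h1 (Fin.succ_lt_succ_iff.2 hxy)
          · intro i
            have := h3 (Fin.succ_pos i)
            simpa [hg] using this
          · intro x y hxy
            have := h3 (Fin.succ_lt_succ_iff.2 hxy)
            simpa [hg] using this
          · exact Subtype.ext hg.symm
        · obtain ⟨g', hg'⟩ := exists_succ_comp g
            (fun i => lt_of_lt_of_le (Fin.pos_iff_ne_zero.2 h0) (h1.monotone (Fin.zero_le i)))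
          subst hg'
          exact ⟨Sum.inl ⟨g', (strictMono_succ_comp _).1 h1, h2, h3⟩, rfl⟩

def OccP {j n : ℕ} (f : Fin n → ℕ) (p : Fin n × (Fin j → Fin n)) : Prop :=
    ∃ h : (p.1 : ℕ) + 1 < n,
      StrictMono p.2 ∧ (∀ i, (⟨(p.1 : ℕ) + 1, h⟩ : Fin n) < p.2 i) ∧
      f ⟨(p.1 : ℕ) + 1, h⟩ < f p.1 ∧ (∀ i, f p.1 < f (p.2 i)) ∧
      StrictMono fun i => f (p.2 i)

/-- first position occurrences -/
theorem card_occ_first (n j : ℕ) (f : Fin (n+1) → ℕ) :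
    Nat.card {g : Fin (j+1) → Fin n // OccP f (0, fun i => (g i).succ)} =
      if (∀ b ∈ (List.ofFn (fun i : Fin n => f i.succ)).head?, b < f 0) then
        linc (j+1) (f 0) (List.ofFn (fun i : Fin n => f i.succ)) else 0 := by
  cases n with
  | zero =>
    simp [linc]
  | succ n =>
    have hd : (∀ b ∈ (List.ofFn (fun i : Fin (n+1) => f i.succ)).head?, b < f 0) ↔ f 1 < f 0 := by
      rw [List.ofFn_succ]; simp
    simp only [hd]
    split_ifs with h
    · rw [← card_inc]
      refine Nat.card_congr (Equiv.subtypeEquivRight fun g => ?_)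
      constructor
      · rintro ⟨_, h1, h2, h3, h4, h5⟩
        exact ⟨(strictMono_succ_comp _).1 h1, h4, h5⟩
      · rintro ⟨h1, h2, h3⟩
        refine ⟨by simp, (strictMono_succ_comp _).2 h1, ?_, h, h2, h3⟩
        intro i
        have h4 := h2 i
        have : g i ≠ 0 := by
          intro h0
          rw [h0] at h4
          simp only [Fin.succ_zero_eq_one] at h4
          exact absurd h4 (by simpa using h.le)
        have : (g i : ℕ) ≠ 0 := fun h => this (Fin.ext h)
        rw [Fin.lt_def]
        change 0 + 1 < (g i : ℕ) + 1
        omega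
    · rw [Nat.card_eq_zero]; left
      refine ⟨fun g => h ?_⟩
      obtain ⟨_, _, _, h3, _⟩ := g.2
      exact h3

theorem card_occ : ∀ (n j : ℕ) (f : Fin n → ℕ),
    Nat.card {p : Fin n × (Fin (j+1) → Fin n) // OccP f p} = locc (j+1) (List.ofFn f) := by
  intro n
  induction n with
  | zero =>
    intro j f
    simp [locc]
  | succ n ih =>
    intro j f
    rw [List.ofFn_succ, locc, ← ih, ← card_occ_first, ← Nat.card_sum]
    symm
    refine Nat.card_congr (Equiv.ofBijective
        (fun x : {p : Fin n × (Fin (j+1) → Fin n) // OccP (fun i => f i.succ) p} ⊕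
            {g : Fin (j+1) → Fin n // OccP f (0, fun i => (g i).succ)} =>
          (match x with
          | Sum.inl p => ⟨(p.1.1.succ, fun i => (p.1.2 i).succ), ?_⟩
          | Sum.inr g => ⟨(0, fun i => (g.1 i).succ), g.2⟩ :
            {p : Fin (n+1) × (Fin (j+1) → Fin (n+1)) // OccP f p})) ⟨?_, ?_⟩)
    · obtain ⟨⟨b, g⟩, hb, h1, h2, h3, h4, h5⟩ := p
      exact ⟨by simpa using hb, (strictMono_succ_comp _).2 h1,
        fun i => Fin.succ_lt_succ_iff.2 (h2 i), h3, h4, h5⟩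
    · rintro (⟨⟨b, g⟩, hg⟩ | ⟨g, hg⟩) (⟨⟨b', g'⟩, hg'⟩ | ⟨g', hg'⟩) h
      · simp only [Subtype.mk.injEq, Prod.mk.injEq, Fin.succ_inj] at h
        obtain ⟨rfl, h⟩ := h
        congr 3
        ext i
        have := congrFun h i
        simpa [Fin.ext_iff] using this
      · simp only [Subtype.mk.injEq, Prod.mk.injEq] at h
        exact absurd h.1 (Fin.succ_ne_zero _)
      · simp only [Subtype.mk.injEq, Prod.mk.injEq] at h
        exact absurd h.1.symm (Fin.succ_ne_zero _)
      · simp only [Subtype.mk.injEq, Prod.mk.injEq] at h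
        congr 2
        ext i
        have := congrFun h.2 i
        simpa [Fin.ext_iff] using this
    · rintro ⟨⟨b, g⟩, hh⟩
      obtain ⟨g', rfl⟩ := exists_succ_comp g (fun i => by
        obtain ⟨_, _, h2, _⟩ := hh
        exact lt_of_le_of_lt (Fin.zero_le _) (h2 i))
      rcases Fin.eq_zero_or_eq_succ b with rfl | ⟨b, rfl⟩
      · exact ⟨Sum.inr ⟨g', hh⟩, rfl⟩
      · obtain ⟨hb, h1, h2, h3, h4, h5⟩ := hh
        exact ⟨Sum.inl ⟨(b, g'), by simpa using hb, (strictMono_succ_comp _).1 h1,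
          fun i => Fin.succ_lt_succ_iff.1 (h2 i), h3, h4, h5⟩, rfl⟩

theorem occ_eq (j : ℕ) {n : ℕ} (π : Equiv.Perm (Fin n)) :
    occ21_3k (j+3) π = locc (j+1) (List.ofFn fun i => (π i : ℕ)) := by
  rw [← card_occ]
  rfl

theorem motzkin_iff {n : ℕ} (π : Equiv.Perm (Fin n)) : IsMotzkinPerm π ↔
    L132 (List.ofFn fun i => (π i : ℕ)) ∧ L123 (List.ofFn fun i => (π i : ℕ)) := by
  rw [L132_ofFn, L123_ofFn]
  rfl

theorem arr_perm {n : ℕ} (π : Equiv.Perm (Fin n)) : Arr 0 (List.ofFn fun i => (π i : ℕ)) := by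
  refine ⟨?_, fun x => ?_⟩
  · rw [List.nodup_ofFn]
    exact Fin.val_injective.comp π.injective
  · simp only [List.mem_ofFn, List.length_ofFn, zero_add, zero_le, true_and]
    constructor
    · rintro ⟨i, rfl⟩; exact (π i).2
    · intro h
      exact ⟨π.symm ⟨x, h⟩, by simp⟩

theorem exists_perm {n : ℕ} (l : List ℕ) (hl : l.length = n) (h : Arr 0 l) :
    ∃ π : Equiv.Perm (Fin n), (List.ofFn fun i => (π i : ℕ)) = l := by
  subst hl
  have hlt : ∀ i : Fin l.length, l.get i < l.length := fun i => by
    have := (h.2 (l.get i)).1 (List.get_mem l i)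
    omega
  have hinj : Function.Injective (fun i : Fin l.length => (⟨l.get i, hlt i⟩ : Fin l.length)) := by
    intro a b hab
    simp only [Fin.mk.injEq] at hab
    exact (List.nodup_iff_injective_get.1 h.1) hab
  refine ⟨Equiv.ofBijective _ (Finite.injective_iff_bijective.1 hinj), ?_⟩
  simp

theorem card_perm_eq (j n r : ℕ) :
    Nat.card {π : Equiv.Perm (Fin n) // IsMotzkinPerm π ∧ occ21_3k (j+3) π = r} =
    Nat.card {t : MT // MT.size t = n ∧ MT.o (j+1) t = r} := by
  have key : ∀ t : {t : MT // MT.size t = n ∧ MT.o (j+1) t = r},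
      ∃ π : {π : Equiv.Perm (Fin n) // IsMotzkinPerm π ∧ occ21_3k (j+3) π = r},
        (List.ofFn fun i => (π.1 i : ℕ)) = MT.toL t.1 0 := by
    rintro ⟨t, h1, h2⟩
    obtain ⟨π, hπ⟩ := exists_perm (n := n) (MT.toL t 0) (by rw [MT.length_toL, h1]) (MT.arr_toL t 0)
    refine ⟨⟨π, ?_, ?_⟩, hπ⟩
    · rw [motzkin_iff, hπ]
      exact ⟨MT.L132_toL t 0, MT.L123_toL t 0⟩
    · rw [occ_eq, hπ, MT.locc_toL, h2]
  choose F hF using key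
  refine (Nat.card_congr (Equiv.ofBijective F ⟨?_, ?_⟩)).symm
  · intro a b hab
    have h1 := hF a
    rw [hab, hF b] at h1
    exact Subtype.ext (MT.toL_inj _ _ _ h1.symm)
  · rintro ⟨π, h1, h2⟩
    rw [motzkin_iff] at h1
    obtain ⟨t, ht⟩ := MT.toL_surj n 0 _ (by simp) (arr_perm π) h1.1 h1.2
    rw [occ_eq, ← ht, MT.locc_toL] at h2
    have h3 : MT.size t = n := by rw [← MT.length_toL t 0, ht]; simp
    refine ⟨⟨t, h3, h2⟩, ?_⟩
    apply Subtype.ext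
    have := hF ⟨t, h3, h2⟩
    rw [ht] at this
    have := List.ofFn_injective this
    ext i
    exact congrFun this i

open PowerSeries in
/-- For `k ≥ 3`, the generating functions `N_r` for Motzkin permutations with exactly `r`
occurrences of the generalized pattern `21-3-…-k` satisfy
`N₀ (q_{k-2} - x² q_{k-3}) = q_{k-3} - x² q_{k-4}` and, for `1 ≤ r ≤ k-1`,
`N_r (q_{k-2} - x² q_{k-3})^{r+1} = x^{2k+r-4} (1+x)^r q_{k-2}^{r-1}`. -/
theorem count_21_3k_occurrences (k : ℕ) (hk : 3 ≤ k) :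
    ((PowerSeries.mk fun n =>
        (Nat.card {π : Equiv.Perm (Fin n) // IsMotzkinPerm π ∧ occ21_3k k π = 0} : ℚ)) *
      (qcheb (k - 1) - X ^ 2 * qcheb (k - 2)) = qcheb (k - 2) - X ^ 2 * qcheb (k - 3)) ∧
    ∀ r : ℕ, 1 ≤ r → r ≤ k - 1 →
      (PowerSeries.mk fun n =>
          (Nat.card {π : Equiv.Perm (Fin n) // IsMotzkinPerm π ∧ occ21_3k k π = r} : ℚ)) *
        (qcheb (k - 1) - X ^ 2 * qcheb (k - 2)) ^ (r + 1) =
        X ^ (2 * k + r - 4) * (1 + X) ^ r * qcheb (k - 1) ^ (r - 1) := by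
  obtain ⟨j, rfl⟩ : ∃ j, k = j + 3 := ⟨k - 3, by omega⟩
  have key : ∀ r, r ≤ j + 2 → (PowerSeries.mk fun n =>
      (Nat.card {π : Equiv.Perm (Fin n) // IsMotzkinPerm π ∧ occ21_3k (j+3) π = r} : ℚ)) =
      MT.A (j+1) r := by
    intro r hr
    rw [MT.coeff_A (j+1) r (by omega)]
    simp only [card_perm_eq]
  constructor
  · rw [key 0 (by omega)]
    exact MT.A_final_zero j
  · intro r h1 h2
    obtain ⟨r, rfl⟩ : ∃ s, r = s + 1 := ⟨r - 1, by omega⟩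
    rw [key (r+1) (by omega)]
    have := MT.A_final j r
    rw [show 2 * (j+3) + (r+1) - 4 = 2*j+2+(r+1) by omega]
    exact this
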